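/- arXiv:1905.09539 — 3 statements merged into one kernel-verified Lean document; each statement's English description precedes it below -/
import Mathlib

section
/- Let A₁ ∈ ℂ^{n₁×n₁} and A₂ ∈ ℂ^{n₂×n₂} be quasi-triangular, with monotone block maps b₁ : {1,…,n₁} → ℕ and b₂ : {1,…,n₂} → ℕ each of whose fibers has at most 2 elements, such that A₁ is block upper triangular with respect to b₁ and A₂ with respect to b₂. Then the matrix M = I_{n₂} ⊗ A₁ + A₂ ⊗ I_{n₁}, with entries M((i₂,i₁),(j₂,j₁)) = [i₂ = j₂]·A₁(i₁,j₁) + A₂(i₂,j₂)·[i₁ = j₁], is block upper triangular with respect to the map (i₂,i₁) ↦ (b₂(i₂), b₁(i₁)) into ℕ × ℕ with the lexicographic order, and every fiber of this map has at most 4 elements (i.e., after a perfect-shuffle reordering M is block upper triangular with diagonal blocks of size at most 4). -/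
open Matrix Finset

/-- If `A₁` and `A₂` are quasi-triangular, with monotone block maps whose fibers
have at most 2 elements, then `M = I ⊗ A₁ + A₂ ⊗ I` is block upper triangular with
respect to the lexicographic block map `(i₂, i₁) ↦ (b₂ i₂, b₁ i₁)`, whose fibers
have at most 4 elements. -/
theorem merged_quasi_triangular_laplace {n₁ n₂ : ℕ}
    (b₁ : Fin n₁ → ℕ) (b₂ : Fin n₂ → ℕ)
    (hb₁ : Monotone b₁) (hb₂ : Monotone b₂)
    (hb₁card : ∀ t : ℕ, (Finset.univ.filter fun i => b₁ i = t).card ≤ 2)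
    (hb₂card : ∀ t : ℕ, (Finset.univ.filter fun i => b₂ i = t).card ≤ 2)
    (A₁ : Matrix (Fin n₁) (Fin n₁) ℂ) (A₂ : Matrix (Fin n₂) (Fin n₂) ℂ)
    (hA₁ : Matrix.BlockTriangular A₁ b₁) (hA₂ : Matrix.BlockTriangular A₂ b₂)
    (M : Matrix (Fin n₂ × Fin n₁) (Fin n₂ × Fin n₁) ℂ)
    (hM : ∀ p q : Fin n₂ × Fin n₁, M p q =
      (if p.1 = q.1 then (1 : ℂ) else 0) * A₁ p.2 q.2
        + A₂ p.1 q.1 * (if p.2 = q.2 then (1 : ℂ) else 0)) :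
    Matrix.BlockTriangular M (fun p => toLex (b₂ p.1, b₁ p.2)) ∧
      ∀ t : ℕ × ℕ,
        (Finset.univ.filter
          fun p : Fin n₂ × Fin n₁ => (b₂ p.1, b₁ p.2) = t).card ≤ 4 := by
  refine ⟨fun p q hqp => ?_, fun t => ?_⟩
  · rw [hM]
    rcases Prod.Lex.toLex_lt_toLex.mp hqp with h | ⟨-, h⟩
    · have hne : p.1 ≠ q.1 := fun e => h.ne (congrArg b₂ e.symm)
      rw [if_neg hne, hA₂ h, zero_mul, zero_mul, add_zero]
    · have hne : p.2 ≠ q.2 := fun e => h.ne (congrArg b₁ e.symm)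
      rw [if_neg hne, hA₁ h, mul_zero, mul_zero, add_zero]
  · have hfiber : (Finset.univ.filter
        fun p : Fin n₂ × Fin n₁ => (b₂ p.1, b₁ p.2) = t) =
        (Finset.univ.filter fun i => b₂ i = t.1) ×ˢ
          (Finset.univ.filter fun i => b₁ i = t.2) := by
      ext p
      simp [Prod.ext_iff]
    rw [hfiber, Finset.card_product]
    exact Nat.mul_le_mul (hb₂card t.1) (hb₁card t.2)
end

section
/- Let A₁, C ∈ ℂ^{n×n} and K ∈ ℂ^{m×m}. The matrix M = I_m ⊗ A₁ + K ⊗ C, indexed by pairs (i,p) ∈ {1,…,m}×{1,…,n} with entries M((i,p),(j,q)) = [i = j]·A₁(p,q) + K(i,j)·C(p,q), is invertible if and only if for every eigenvalue μ of K the matrix A₁ + μ·C is invertible. -/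
open Matrix

/-- Under the identification of vectors indexed by pairs with matrices, `I ⊗ A + K ⊗ C` acts as
`X ↦ X Aᵀ + K X Cᵀ`. -/
lemma mulVec_eq_mul_transpose_add {m n : Type*} [Fintype m] [Fintype n] [DecidableEq m]
    (A C : Matrix n n ℂ) (K : Matrix m m ℂ) (M : Matrix (m × n) (m × n) ℂ)
    (hM : ∀ x y : m × n, M x y =
      (if x.1 = y.1 then (1 : ℂ) else 0) * A x.2 y.2 + K x.1 y.1 * C x.2 y.2)
    (X : Matrix m n ℂ) (i : m) (p : n) :
    (M *ᵥ fun y => X y.1 y.2) (i, p) = (X * Aᵀ + K * (X * Cᵀ)) i p := by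
  simp only [mulVec, dotProduct, hM, Fintype.sum_prod_type, add_mul, Finset.sum_add_distrib,
    Matrix.add_apply, Matrix.mul_apply, transpose_apply, Finset.mul_sum]
  congr 1
  · rw [Finset.sum_eq_single i]
    · simp [mul_comm]
    · intro j _ hj
      simp [hj.symm]
    · simp
  · refine Finset.sum_congr rfl fun j _ => Finset.sum_congr rfl fun q _ => ?_
    ring

/-- The solution space of `X A + K X B = 0` is stable under left multiplication by `K`, so a
nonzero solution yields one satisfying `K X = μ X`. -/
lemma exists_mul_eq_smul_of_mul_add_mul_eq_zero {m n : Type*} [Fintype m] [Fintype n]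
    (A B : Matrix n n ℂ) (K : Matrix m m ℂ) {X : Matrix m n ℂ} (hX : X ≠ 0)
    (h : X * A + K * (X * B) = 0) :
    ∃ (μ : ℂ) (Y : Matrix m n ℂ), Y ≠ 0 ∧ K * Y = μ • Y ∧ Y * (A + μ • B) = 0 := by
  let S : Submodule ℂ (Matrix m n ℂ) :=
    { carrier := {Y | Y * A + K * (Y * B) = 0}
      zero_mem' := by simp
      add_mem' := by
        intro Y Z hY hZ
        simp only [Set.mem_ofPred_eq] at *
        rw [Matrix.add_mul, Matrix.add_mul, Matrix.mul_add, add_add_add_comm, hY, hZ, add_zero]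
      smul_mem' := by
        intro c Y hY
        simp only [Set.mem_ofPred_eq] at *
        rw [Matrix.smul_mul, Matrix.smul_mul, Matrix.mul_smul, ← smul_add, hY, smul_zero] }
  let f : Module.End ℂ (Matrix m n ℂ) :=
    { toFun := fun Y => K * Y
      map_add' := Matrix.mul_add K
      map_smul' := fun c Y => Matrix.mul_smul K c Y }
  have hf : ∀ Y ∈ S, f Y ∈ S := by
    intro Y hY
    have hY' : Y * A + K * (Y * B) = 0 := hY
    change K * Y * A + K * (K * Y * B) = 0
    rw [Matrix.mul_assoc K Y A, Matrix.mul_assoc K Y B, ← Matrix.mul_add, hY', Matrix.mul_zero]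
  have : Nontrivial S := ⟨⟨⟨X, h⟩, 0, fun e => hX (congrArg Subtype.val e)⟩⟩
  obtain ⟨μ, hμ⟩ := Module.End.exists_eigenvalue (f.restrict hf)
  obtain ⟨Y, hY⟩ := hμ.exists_hasEigenvector
  have hKY : K * Y.1 = μ • Y.1 := congrArg Subtype.val hY.apply_eq_smul
  refine ⟨μ, Y.1, fun e => hY.2 (Subtype.ext e), hKY, ?_⟩
  have hY' : Y.1 * A + K * (Y.1 * B) = 0 := Y.2
  rwa [← Matrix.mul_assoc, hKY, Matrix.smul_mul, ← Matrix.mul_smul, ← Matrix.mul_add] at hY'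

/-- The matrix `M = I_m ⊗ A₁ + K ⊗ C` is invertible iff `A₁ + μ·C` is invertible
for every eigenvalue `μ` of `K`. -/
theorem gen_sylvester_kron_isUnit_iff {n m : ℕ}
    (A₁ C : Matrix (Fin n) (Fin n) ℂ) (K : Matrix (Fin m) (Fin m) ℂ)
    (M : Matrix (Fin m × Fin n) (Fin m × Fin n) ℂ)
    (hM : ∀ x y : Fin m × Fin n, M x y =
      (if x.1 = y.1 then (1 : ℂ) else 0) * A₁ x.2 y.2 + K x.1 y.1 * C x.2 y.2) :
    IsUnit M ↔ ∀ μ : ℂ, (K - μ • 1).det = 0 → IsUnit (A₁ + μ • C) := by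
  have key := mulVec_eq_mul_transpose_add A₁ C K M hM
  constructor
  · intro hU μ hμ
    by_contra hA
    rw [isUnit_iff_isUnit_det, isUnit_iff_ne_zero, not_not] at hA
    obtain ⟨u, hu0, hu⟩ := exists_mulVec_eq_zero_iff.mpr hA
    obtain ⟨w, hw0, hw⟩ := exists_mulVec_eq_zero_iff.mpr hμ
    have hw' : K *ᵥ w = μ • w := by
      simpa [sub_mulVec, smul_mulVec, sub_eq_zero] using hw
    rw [isUnit_iff_isUnit_det, isUnit_iff_ne_zero] at hU
    refine hU (exists_mulVec_eq_zero_iff.mp ⟨fun y => vecMulVec w u y.1 y.2, ?_, ?_⟩)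
    · obtain ⟨i, hi⟩ := Function.ne_iff.mp hw0
      obtain ⟨p, hp⟩ := Function.ne_iff.mp hu0
      exact fun e => mul_ne_zero hi hp (congrFun e (i, p))
    · ext ⟨i, p⟩
      rw [key, ← Matrix.mul_assoc, mul_vecMulVec, hw', smul_vecMulVec, Matrix.smul_mul,
        ← Matrix.mul_smul, ← Matrix.mul_add, ← transpose_smul, ← transpose_add, vecMulVec_mul,
        vecMul_transpose, hu]
      simp [vecMulVec_apply]
  · intro h
    rw [isUnit_iff_isUnit_det, isUnit_iff_ne_zero]
    intro hdet
    obtain ⟨v, hv0, hv⟩ := exists_mulVec_eq_zero_iff.mpr hdet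
    let X : Matrix (Fin m) (Fin n) ℂ := Matrix.of fun i p => v (i, p)
    have hX : X ≠ 0 := fun e => hv0 (funext fun x => congrFun (congrFun e x.1) x.2)
    have hXM : X * A₁ᵀ + K * (X * Cᵀ) = 0 := by
      ext i p
      rw [← key]
      exact congrFun hv (i, p)
    obtain ⟨μ, Y, hY0, hKY, hYA⟩ := exists_mul_eq_smul_of_mul_add_mul_eq_zero A₁ᵀ Cᵀ K hX hXM
    have hμ : (K - μ • 1).det = 0 := by
      by_contra hne
      have hU : IsUnit (K - μ • 1) := (isUnit_iff_isUnit_det _).mpr (isUnit_iff_ne_zero.mpr hne)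
      obtain ⟨N, hN⟩ := hU.exists_left_inv
      apply hY0
      rw [← Matrix.one_mul Y, ← hN, Matrix.mul_assoc, Matrix.sub_mul, hKY, Matrix.smul_mul,
        Matrix.one_mul, sub_self, Matrix.mul_zero]
    obtain ⟨N, hN⟩ := (h μ hμ).exists_left_inv
    apply hY0
    rw [← Matrix.mul_one Y, ← transpose_one, ← hN, transpose_mul, ← Matrix.mul_assoc,
      transpose_add, transpose_smul, hYA, Matrix.zero_mul]
end

section
/- Let A₁ ∈ ℂ^{n₁×n₁}, A₂ ∈ ℂ^{n₂×n₂}, A₃ ∈ ℂ^{n₃×n₃}, and let X, B : {1,…,n₁}×{1,…,n₂}×{1,…,n₃} → ℂ. Define the matrices X', B' ∈ ℂ^{(n₂·n₁)×n₃}, indexed by rows (i₂,i₁) ∈ {1,…,n₂}×{1,…,n₁} and columns i₃, by X'((i₂,i₁), i₃) = X(i₁,i₂,i₃) and B'((i₂,i₁), i₃) = B(i₁,i₂,i₃), and let A₁' = I_{n₂} ⊗ A₁ + A₂ ⊗ I_{n₁}. Then the three-dimensional Laplace-like equation Σ_j A₁(i₁,j)X(j,i₂,i₃) + Σ_j A₂(i₂,j)X(i₁,j,i₃)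 + Σ_j A₃(i₃,j)X(i₁,i₂,j) = B(i₁,i₂,i₃) for all (i₁,i₂,i₃) holds if and only if the Sylvester matrix equation A₁'X' + X'A₃ᵀ = B' holds. -/
open Matrix BigOperators

/-- Correctness of merging the first two dimensions of a third-order Laplace-like
tensor equation into a single Sylvester matrix equation `A₁' X' + X' A₃ᵀ = B'`,
where `A₁' = I_{n₂} ⊗ A₁ + A₂ ⊗ I_{n₁}`. -/
theorem laplace_merge_dim3 {n₁ n₂ n₃ : ℕ}
    (A₁ : Matrix (Fin n₁) (Fin n₁) ℂ) (A₂ : Matrix (Fin n₂) (Fin n₂) ℂ)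
    (A₃ : Matrix (Fin n₃) (Fin n₃) ℂ)
    (X B : Fin n₁ × Fin n₂ × Fin n₃ → ℂ)
    (X' B' : Matrix (Fin n₂ × Fin n₁) (Fin n₃) ℂ)
    (hX' : ∀ (p : Fin n₂ × Fin n₁) (i₃ : Fin n₃), X' p i₃ = X (p.2, p.1, i₃))
    (hB' : ∀ (p : Fin n₂ × Fin n₁) (i₃ : Fin n₃), B' p i₃ = B (p.2, p.1, i₃))
    (A₁' : Matrix (Fin n₂ × Fin n₁) (Fin n₂ × Fin n₁) ℂ)
    (hA₁' : ∀ p q : Fin n₂ × Fin n₁, A₁' p q =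
      (if p.1 = q.1 then (1 : ℂ) else 0) * A₁ p.2 q.2
        + A₂ p.1 q.1 * (if p.2 = q.2 then (1 : ℂ) else 0)) :
    (∀ (i₁ : Fin n₁) (i₂ : Fin n₂) (i₃ : Fin n₃),
        (∑ j, A₁ i₁ j * X (j, i₂, i₃)) + (∑ j, A₂ i₂ j * X (i₁, j, i₃))
          + (∑ j, A₃ i₃ j * X (i₁, i₂, j)) = B (i₁, i₂, i₃)) ↔
      A₁' * X' + X' * A₃ᵀ = B' := by
  have entry (i₁ : Fin n₁) (i₂ : Fin n₂) (i₃ : Fin n₃) :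
      (A₁' * X' + X' * A₃ᵀ) (i₂, i₁) i₃ =
        (∑ j, A₁ i₁ j * X (j, i₂, i₃)) + (∑ j, A₂ i₂ j * X (i₁, j, i₃))
          + (∑ j, A₃ i₃ j * X (i₁, i₂, j)) := by
    simp only [Matrix.add_apply, Matrix.mul_apply, Matrix.transpose_apply, hX', hA₁',
      Fintype.sum_prod_type, add_mul, Finset.sum_add_distrib]
    congr 1
    · congr 1
      · rw [Finset.sum_comm]
        simp
      · simp
    · exact Finset.sum_congr rfl fun j _ => mul_comm _ _
  constructor
  · intro h
    ext ⟨i₂, i₁⟩ i₃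
    rw [entry, h, hB']
  · intro h i₁ i₂ i₃
    rw [← entry, h, hB']
end
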